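/- Let G be an almost Moore digraph of degree d > 1 and diameter k > 1 with self-repeats whose permutation cycle structure is 2-critical. Then ord_r(v) ≤ d − 1 for every vertex v of G. -/

import Mathlib

/-- `IsWalkFrom A u v l` : the list `u :: l` is a directed walk from `u` to `v`
along the adjacency relation `A`; the length of the walk is `l.length`. -/
def IsWalkFrom {V : Type} (A : V → V → Prop) (u v : V) (l : List V) : Prop :=
  List.Chain A u l ∧ (u :: l).getLast (List.cons_ne_nil u l) = v

/-- An almost Moore digraph (a `(d,k)`-digraph): a diregular digraph of degree `d > 1`,
diameter `k > 1` and order `d + d² + ⋯ + d^k`, together with its repeat permutation `rep`: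
for every vertex `v`, every vertex `w ≠ rep v` is reached from `v` by exactly one walk of
length at most `k`, while `rep v` is reached by exactly two such walks, at least one of
which has length `k`.  The map `rep` is an automorphism of the digraph. -/
structure AlmostMooreDigraph (d k : ℕ) where
  hd : 1 < d
  hk : 1 < k
  V : Type
  [fintypeV : Fintype V]
  [decEqV : DecidableEq V]
  Adj : V → V → Prop
  [adjDec : DecidableRel Adj]
  loopless : ∀ v, ¬ Adj v v
  out_deg : ∀ v, {w | Adj v w}.ncard = d
  in_deg : ∀ v, {w | Adj w v}.ncard = d
  reach : ∀ u v, ∃ l, IsWalkFrom Adj u v l ∧ l.length ≤ k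
  diam : ∃ u v, ∀ l, IsWalkFrom Adj u v l → k ≤ l.length
  card_eq : Fintype.card V = ∑ i ∈ Finset.range k, d ^ (i + 1)
  rep : V → V
  rep_spec : ∀ v w, w ≠ rep v → ∃! l, IsWalkFrom Adj v w l ∧ l.length ≤ k
  rep_two : ∀ v, ∃ l₁ l₂, l₁ ≠ l₂ ∧
      IsWalkFrom Adj v (rep v) l₁ ∧ l₁.length ≤ k ∧
      IsWalkFrom Adj v (rep v) l₂ ∧ l₂.length ≤ k ∧
      (l₁.length = k ∨ l₂.length = k) ∧
      (∀ l, IsWalkFrom Adj v (rep v) l → l.length ≤ k → l = l₁ ∨ l = l₂)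
  rep_bijective : Function.Bijective rep
  rep_adj : ∀ u v, Adj u v ↔ Adj (rep u) (rep v)

attribute [instance] AlmostMooreDigraph.fintypeV AlmostMooreDigraph.decEqV
  AlmostMooreDigraph.adjDec

/-- `ordRep M v` : the smallest `t ≥ 1` with `rep^t v = v`. -/
noncomputable def ordRep {d k : ℕ} (M : AlmostMooreDigraph d k) (v : M.V) : ℕ :=
  sInf {t | 0 < t ∧ M.rep^[t] v = v}

/-- The vertex set of the subdigraph `H_α`: vertices whose order under the repeat
permutation divides `2^t * α` for some `t ≥ 0`. -/
def Hset {d k : ℕ} (M : AlmostMooreDigraph d k) (α : ℕ) : Set M.V :=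
  {v | ∃ t : ℕ, ordRep M v ∣ 2 ^ t * α}

/-- A set `S` of vertices (closed under the repeat map) has 2-critical permutation cycle
structure if there is a unique index `α > 1` such that every index `j > 1` occurring as
the order of some vertex of `S` (i.e. with `m_j ≠ 0`) is of the form `j = 2^t * α` for
some `t ≥ 0`. -/
def TwoCriticalOn {d k : ℕ} (M : AlmostMooreDigraph d k) (S : Set M.V) : Prop :=
  ∃! α : ℕ, 1 < α ∧ ∀ j : ℕ, 1 < j → (∃ v ∈ S, ordRep M v = j) → ∃ t : ℕ, j = 2 ^ t * α

namespace IsWalkFrom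

variable {V : Type} {A : V → V → Prop} {u v w x : V} {l : List V}

set_option linter.deprecated false in
theorem nil_iff : IsWalkFrom A u v [] ↔ u = v := by
  simp [IsWalkFrom, List.Chain]

set_option linter.deprecated false in
theorem cons_iff : IsWalkFrom A u v (x :: l) ↔ A u x ∧ IsWalkFrom A x v l := by
  simp [IsWalkFrom, List.Chain, and_assoc]

theorem concat_iff :
    IsWalkFrom A u v (l ++ [w]) ↔ w = v ∧ ∃ y, IsWalkFrom A u y l ∧ A y w := by
  induction l generalizing u with
  | nil => simp [cons_iff, nil_iff]; tauto
  | cons a l ih => simp only [List.cons_append, cons_iff, ih]; grind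

theorem map {f : V → V} (hf : ∀ a b, A a b → A (f a) (f b)) (h : IsWalkFrom A u v l) :
    IsWalkFrom A (f u) (f v) (l.map f) := by
  induction l generalizing u with
  | nil => simpa [nil_iff] using congrArg f (nil_iff.1 h)
  | cons a l ih =>
    rw [List.map_cons, cons_iff]
    exact ⟨hf _ _ (cons_iff.1 h).1, ih (cons_iff.1 h).2⟩

theorem target_mem (h : IsWalkFrom A u v l) : v ∈ u :: l :=
  h.2 ▸ List.getLast_mem _

/-- A walk from a vertex satisfying `p` to one that does not has an arc leaving `p`. -/
theorem exists_exit {p : V → Prop} (h : IsWalkFrom A u v l) (hu : p u) (hv : ¬ p v) :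
    ∃ a ∈ u :: l, ∃ b ∈ l, A a b ∧ p a ∧ ¬ p b := by
  induction l generalizing u with
  | nil => exact absurd (nil_iff.1 h ▸ hu) hv
  | cons c l ih =>
    rw [cons_iff] at h
    by_cases hc : p c
    · obtain ⟨a, ha, b, hb, hab⟩ := ih h.2 hc
      exact ⟨a, List.mem_cons_of_mem _ ha, b, List.mem_cons_of_mem _ hb, hab⟩
    · exact ⟨u, List.mem_cons_self, c, List.mem_cons_self, h.1, hu, hc⟩

end IsWalkFrom

namespace AlmostMooreDigraph

open Function

variable {d k : ℕ} (M : AlmostMooreDigraph d k)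

theorem adj_iterate (n : ℕ) {u v : M.V} (h : M.Adj u v) :
    M.Adj (M.rep^[n] u) (M.rep^[n] v) := by
  induction n with
  | zero => exact h
  | succ n ih => simpa only [iterate_succ_apply'] using (M.rep_adj _ _).1 ih

/-- A short walk between two points fixed by a power of `rep`, when it is the only one, is
fixed pointwise. -/
theorem isPeriodicPt_of_mem_walk {n : ℕ} {u w : M.V} {l : List M.V}
    (hu : IsPeriodicPt M.rep n u) (hw : IsPeriodicPt M.rep n w) (hne : w ≠ M.rep u)
    (hl : IsWalkFrom M.Adj u w l) (hlen : l.length ≤ k) :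
    ∀ x ∈ u :: l, IsPeriodicPt M.rep n x := by
  have h := hl.map (f := M.rep^[n]) fun a b hab => M.adj_iterate n hab
  rw [hu.eq, hw.eq] at h
  have hmap : l.map M.rep^[n] = l :=
    (M.rep_spec u w hne).unique ⟨h, by simpa using hlen⟩ ⟨hl, hlen⟩
  intro x hx
  rcases List.mem_cons.1 hx with rfl | hx
  · exact hu
  · exact List.map_inj_left.1 (hmap.trans (List.map_id l).symm) x hx

theorem minimalPeriod_pos (v : M.V) : 0 < minimalPeriod M.rep v :=
  minimalPeriod_pos_of_mem_periodicPts (M.rep_bijective.1.mem_periodicPts v)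

theorem ordRep_eq_minimalPeriod (v : M.V) : ordRep M v = minimalPeriod M.rep v :=
  le_antisymm (Nat.sInf_le ⟨M.minimalPeriod_pos v, iterate_minimalPeriod⟩)
    (le_csInf ⟨_, M.minimalPeriod_pos v, iterate_minimalPeriod⟩
      fun _ ht => IsPeriodicPt.minimalPeriod_le ht.1 ht.2)

/-- A self-repeat has an out-neighbour which is a self-repeat. -/
theorem exists_adj_fixed {v : M.V} (hv : M.rep v = v) :
    ∃ w, M.Adj v w ∧ M.rep w = w := by
  obtain ⟨l₁, l₂, hne, h₁, hk₁, h₂, hk₂, -, hall⟩ := M.rep_two v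
  obtain ⟨a, l, hl, hlk⟩ : ∃ a l, IsWalkFrom M.Adj v v (a :: l) ∧ (a :: l).length ≤ k := by
    rw [hv] at h₁ h₂
    cases l₁ with
    | cons a l => exact ⟨a, l, h₁, hk₁⟩
    | nil => cases l₂ with
      | nil => exact absurd rfl hne
      | cons a l => exact ⟨a, l, h₂, hk₂⟩
  refine ⟨a, (IsWalkFrom.cons_iff.1 hl).1, ?_⟩
  have hmap := hl.map fun a b => (M.rep_adj a b).1
  have h0 : IsWalkFrom M.Adj v v [] := IsWalkFrom.nil_iff.2 rfl
  rw [hv] at hall hmap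
  have e0 := hall _ h0 (by simp)
  have e1 := hall _ hl hlk
  have e2 := hall _ hmap (by simpa using hlk)
  have : (a :: l).map M.rep = a :: l := by
    rcases e0 with e0 | e0 <;> rcases e1 with e1 | e1 <;> rcases e2 with e2 | e2 <;> simp_all
  exact (List.cons.inj this).1

/-- If `u → x` is an arc of `Fix (rep ^ m)` leaving `Fix (rep ^ n)`, some arc of
`Fix (rep ^ m)` enters any self-repeat `w` not adjacent from `rep u` from outside
`Fix (rep ^ n)`. -/
theorem exists_adj_to_of_adj_from {m n : ℕ} {u x w : M.V} (hw : M.rep w = w)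
    (hu : IsPeriodicPt M.rep n u) (hx : IsPeriodicPt M.rep m x)
    (hxn : ¬ IsPeriodicPt M.rep n x) (hux : M.Adj u x) (huw : ¬ M.Adj (M.rep u) w) :
    ∃ y, M.Adj y w ∧ IsPeriodicPt M.rep m y ∧ ¬ IsPeriodicPt M.rep n y := by
  have hwp (i : ℕ) : IsPeriodicPt M.rep i w := IsFixedPt.isPeriodicPt hw i
  have hxw : w ≠ M.rep x := fun h => huw (h ▸ (M.rep_adj u x).1 hux)
  obtain ⟨l, ⟨hl, hlk⟩, -⟩ := M.rep_spec x w hxw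
  have hmem := M.isPeriodicPt_of_mem_walk hx (hwp m) hxw hl hlk
  rcases List.eq_nil_or_concat' l with rfl | ⟨l, b, rfl⟩
  · exact absurd (IsWalkFrom.nil_iff.1 hl ▸ hwp n) hxn
  obtain ⟨rfl, y, hy, hyw⟩ := IsWalkFrom.concat_iff.1 hl
  refine ⟨y, hyw, hmem y ?_, fun hyn => hxn ?_⟩
  · have := hy.target_mem
    simp only [List.mem_cons, List.mem_append] at this ⊢
    tauto
  · exact M.isPeriodicPt_of_mem_walk hu hyn (fun h => huw (h ▸ hyw))
      (IsWalkFrom.cons_iff.2 ⟨hux, hy⟩) (by simpa using hlk) x (by simp)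

/-- If an arc of `Fix (rep ^ m)` enters the self-repeat `w` from outside `Fix (rep ^ n)`, then
another one leaves `w` to the outside of `Fix (rep ^ n)`. -/
theorem exists_adj_from_of_adj_to {m n : ℕ} {w y : M.V} (hw : M.rep w = w)
    (hy : IsPeriodicPt M.rep m y) (hyn : ¬ IsPeriodicPt M.rep n y) (hyw : M.Adj y w) :
    ∃ x, M.Adj w x ∧ IsPeriodicPt M.rep m x ∧ ¬ IsPeriodicPt M.rep n x := by
  have hwp (i : ℕ) : IsPeriodicPt M.rep i w := IsFixedPt.isPeriodicPt hw i
  have hne : y ≠ M.rep w := by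
    rw [hw]
    rintro rfl
    exact hyn (hwp n)
  obtain ⟨l, ⟨hl, hlk⟩, -⟩ := M.rep_spec w y hne
  have hmem := M.isPeriodicPt_of_mem_walk (hwp m) hy hne hl hlk
  cases l with
  | nil => exact absurd (IsWalkFrom.nil_iff.1 hl ▸ hwp n) hyn
  | cons x l =>
    obtain ⟨hwx, hl⟩ := IsWalkFrom.cons_iff.1 hl
    refine ⟨x, hwx, hmem x (by simp), fun hxn => hyn ?_⟩
    have hxw : w ≠ M.rep x := by
      intro h
      rw [M.rep_bijective.1 (hw.trans h)] at hwx
      exact M.loopless _ hwx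
    refine M.isPeriodicPt_of_mem_walk hxn (hwp n) hxw
      (IsWalkFrom.concat_iff.2 ⟨rfl, y, hl, hyw⟩) (by simpa using hlk) y ?_
    have := hl.target_mem
    simp only [List.mem_cons, List.mem_append] at this ⊢
    tauto

/-- If `Fix (rep ^ m)` is not contained in `Fix (rep ^ n)`, this is visible among the
out-neighbours of some self-repeat. -/
theorem exists_fixed_adj {m n : ℕ} {v z : M.V} (hv : M.rep v = v)
    (hz : IsPeriodicPt M.rep m z) (hzn : ¬ IsPeriodicPt M.rep n z) :
    ∃ w x, M.rep w = w ∧ M.Adj w x ∧ IsPeriodicPt M.rep m x ∧ ¬ IsPeriodicPt M.rep n x := by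
  have hvp (i : ℕ) : IsPeriodicPt M.rep i v := IsFixedPt.isPeriodicPt hv i
  have hne : z ≠ M.rep v := by
    rw [hv]
    rintro rfl
    exact hzn (hvp n)
  obtain ⟨l, ⟨hl, hlk⟩, -⟩ := M.rep_spec v z hne
  have hmem := M.isPeriodicPt_of_mem_walk (hvp m) hz hne hl hlk
  obtain ⟨u, -, x, hx, hux, hun, hxn⟩ := hl.exists_exit (hvp n) hzn
  have hxm := hmem x (List.mem_cons_of_mem _ hx)
  obtain ⟨w, hw, huw⟩ : ∃ w, M.rep w = w ∧ ¬ M.Adj (M.rep u) w := by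
    obtain ⟨v', hvv', hv'⟩ := M.exists_adj_fixed hv
    by_contra! hcon
    have h' : v' ≠ M.rep (M.rep u) := by
      intro h
      have h1 : v' = M.rep u := M.rep_bijective.1 (hv'.trans h)
      exact M.loopless v' (by simpa [← h1] using hcon v' hv')
    have := (M.rep_spec (M.rep u) v' h').unique (y₁ := [v']) (y₂ := [v, v'])
      ⟨by simp [IsWalkFrom.cons_iff, IsWalkFrom.nil_iff, hcon v' hv'], by simpa using M.hk.le⟩
      ⟨by simp [IsWalkFrom.cons_iff, IsWalkFrom.nil_iff, hcon v hv, hvv'], M.hk⟩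
    simp at this
  obtain ⟨y, hyw, hym, hyn⟩ := M.exists_adj_to_of_adj_from hw hun hxm hxn hux huw
  obtain ⟨x', h⟩ := M.exists_adj_from_of_adj_to hw hym hyn hyw
  exact ⟨w, x', hw, h⟩

/-- The orbit of a nonfixed out-neighbour of a self-repeat lies among its out-neighbours, one
of which is fixed. -/
theorem minimalPeriod_le_of_adj {w x : M.V} (hw : M.rep w = w) (hwx : M.Adj w x)
    (hx : M.rep x ≠ x) : minimalPeriod M.rep x ≤ d - 1 := by
  classical
  obtain ⟨w', hww', hw'⟩ := M.exists_adj_fixed hw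
  set O := (Finset.range (minimalPeriod M.rep x)).image fun i => M.rep^[i] x with hO
  have hcard : O.card = minimalPeriod M.rep x := by
    rw [hO, Finset.card_image_of_injOn, Finset.card_range]
    rw [Finset.coe_range]
    exact iterate_injOn_Iio_minimalPeriod
  have hnot : w' ∉ O := by
    intro h
    obtain ⟨i, -, hi⟩ := Finset.mem_image.1 h
    refine hx ((M.rep_bijective.1.iterate i) ?_)
    rw [← iterate_succ_apply, iterate_succ_apply', hi, hw']
  have hsub : (↑(insert w' O) : Set M.V) ⊆ {b | M.Adj w b} := by
    intro b hb
    rcases Finset.mem_insert.1 (Finset.mem_coe.1 hb) with rfl | hb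
    · exact hww'
    · obtain ⟨i, -, rfl⟩ := Finset.mem_image.1 hb
      have := M.adj_iterate i hwx
      rwa [iterate_fixed hw] at this
  have := Set.ncard_le_ncard hsub (Set.toFinite _)
  rw [M.out_deg, Set.ncard_coe_finset, Finset.card_insert_of_notMem hnot, hcard] at this
  omega

end AlmostMooreDigraph

/-- Any almost Moore digraph with self-repeats whose permutation cycle
structure is 2-critical satisfies `ord_r(v) ≤ d − 1` for every vertex `v`. -/
theorem stmt10 {d k : ℕ} (M : AlmostMooreDigraph d k) (hsr : ∃ v, M.rep v = v)
    (h2c : TwoCriticalOn M Set.univ) :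
    ∀ v : M.V, ordRep M v ≤ d - 1 := by
  intro z
  obtain ⟨v, hv⟩ := hsr
  obtain ⟨α, ⟨hα, hJ⟩, -⟩ := h2c
  simp only [M.ordRep_eq_minimalPeriod, Set.mem_univ, true_and] at hJ ⊢
  have hd := M.hd
  have hpos := M.minimalPeriod_pos
  rcases (Nat.succ_le_of_lt (hpos z)).eq_or_lt with h1 | h1
  · omega
  obtain ⟨t, ht⟩ := hJ _ h1 ⟨z, rfl⟩
  obtain ⟨n, hn0, hnlt, hn⟩ : ∃ n, 0 < n ∧ n < 2 ^ t * α ∧ ∀ s < t, 2 ^ s * α ∣ n := by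
    cases t with
    | zero => exact ⟨1, one_pos, by simpa using hα, by simp⟩
    | succ t =>
      refine ⟨2 ^ t * α, by positivity, ?_, fun s hs => ?_⟩
      · rw [pow_succ]
        have : 0 < 2 ^ t * α := by positivity
        linarith
      · exact Nat.mul_dvd_mul_right (pow_dvd_pow 2 (by omega)) α
  have hzn : ¬ Function.IsPeriodicPt M.rep n z := fun h => by
    have := h.minimalPeriod_le hn0
    omega
  obtain ⟨w, x, hw, hwx, hxm, hxn⟩ :=
    M.exists_fixed_adj hv (Function.isPeriodicPt_minimalPeriod M.rep z) hzn
  have hx : M.rep x ≠ x := fun h => hxn (Function.IsFixedPt.isPeriodicPt h n)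
  have hx1 : 1 < Function.minimalPeriod M.rep x := by
    have := hpos x
    have : Function.minimalPeriod M.rep x ≠ 1 := by
      rwa [Ne, Function.minimalPeriod_eq_one_iff_isFixedPt]
    omega
  obtain ⟨s, hs⟩ := hJ _ hx1 ⟨x, rfl⟩
  have hts : t ≤ s := by
    by_contra! hlt
    exact hxn (Function.isPeriodicPt_iff_minimalPeriod_dvd.2 (hs ▸ hn s hlt))
  calc Function.minimalPeriod M.rep z = 2 ^ t * α := ht
    _ ≤ 2 ^ s * α := Nat.mul_le_mul_right α (Nat.pow_le_pow_right two_pos hts)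
    _ = Function.minimalPeriod M.rep x := hs.symm
    _ ≤ d - 1 := M.minimalPeriod_le_of_adj hw hwx hx
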